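/- arXiv:2405.01462 — 3 statements merged into one kernel-verified Lean document; each statement's English description precedes it below -/
import Mathlib

section
/- Theorem 1 (optimality of epistemic Uncertainty Sampling). For every unobserved node i ∈ U, the epistemic uncertainty equals the relative gain that acquiring the true label of i provides to the posterior probability of the remaining unobserved true labels: u_epi(i) = μ(E_{U \ {i}} | E_O ∩ {y | y i = g i}) / μ(E_{U \ {i}} | E_O). -/
open MeasureTheory ProbabilityTheory

/-- The event that all nodes in `S` carry their ground-truth label under `g`. -/
def groundTruthEvent {V : Type*} {C : ℕ} (g : V → Fin C) (S : Set V) :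
    Set (V → Fin C) :=
  {y | ∀ v ∈ S, y v = g v}

/-- Exchanging the roles of two events `t` and `u` conditionally on `s`. -/
theorem cond_inv_div_cond_inter_inv {Ω : Type*} [MeasurableSpace Ω] (μ : Measure Ω)
    [IsFiniteMeasure μ] {s t u : Set Ω} (hs : MeasurableSet s) (ht : MeasurableSet t)
    (hu : MeasurableSet u) (h : μ (s ∩ t ∩ u) ≠ 0) :
    (μ[|s] t)⁻¹ / (μ[|s ∩ u] t)⁻¹ = μ[|s ∩ t] u / μ[|s] u := by
  rw [cond_apply hs, cond_apply (hs.inter hu), cond_apply (hs.inter ht), cond_apply hs,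
    Set.inter_right_comm s u t]
  have hst : μ (s ∩ t) ≠ 0 := fun h0 => h (measure_mono_null Set.inter_subset_left h0)
  have hsu : μ (s ∩ u) ≠ 0 := fun h0 =>
    h (measure_mono_null (Set.inter_subset_inter_left u Set.inter_subset_left) h0)
  have hs0 : μ s ≠ 0 := fun h0 => hst (measure_mono_null Set.inter_subset_left h0)
  generalize ha : μ s = a at *
  generalize hb : μ (s ∩ t) = b at *
  generalize hc : μ (s ∩ u) = c at *
  generalize hd : μ (s ∩ t ∩ u) = d at *
  lift a to NNReal using ha ▸ measure_ne_top μ s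
  lift b to NNReal using hb ▸ measure_ne_top μ _
  lift c to NNReal using hc ▸ measure_ne_top μ _
  lift d to NNReal using hd ▸ measure_ne_top μ _
  simp only [ne_eq, ENNReal.coe_eq_zero] at h hst hsu hs0
  have hab : a⁻¹ * b ≠ 0 := mul_ne_zero (inv_ne_zero hs0) hst
  have hcd : c⁻¹ * d ≠ 0 := mul_ne_zero (inv_ne_zero hsu) h
  have hac : a⁻¹ * c ≠ 0 := mul_ne_zero (inv_ne_zero hs0) hsu
  rw [← ENNReal.coe_inv hs0, ← ENNReal.coe_inv hst, ← ENNReal.coe_inv hsu]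
  simp only [← ENNReal.coe_mul]
  rw [← ENNReal.coe_inv hab, ← ENNReal.coe_inv hcd, ← ENNReal.coe_div (inv_ne_zero hcd),
    ← ENNReal.coe_div hac]
  congr 1
  field_simp

theorem groundTruthEvent_union {V : Type*} {C : ℕ} (g : V → Fin C) (S T : Set V) :
    groundTruthEvent g (S ∪ T) = groundTruthEvent g S ∩ groundTruthEvent g T := by
  ext y
  simp only [groundTruthEvent, Set.mem_union, Set.mem_inter_iff, Set.mem_ofPred_eq, or_imp,
    forall_and]

theorem groundTruthEvent_singleton {V : Type*} {C : ℕ} (g : V → Fin C) (i : V) :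
    groundTruthEvent g {i} = {y | y i = g i} := by
  simp [groundTruthEvent]

/-- **Theorem 1 (optimality of epistemic Uncertainty Sampling).**
For every unobserved node `i ∈ U = Oᶜ`, the epistemic uncertainty
`u_epi(i) = u_total(i) / u_alea(i) = (c_total i)⁻¹ / (c_alea i)⁻¹`
equals the relative gain that acquiring the true label of `i` provides to the
posterior probability of the remaining unobserved true labels:
`u_epi(i) = μ(E_{U \ {i}} | E_O ∩ {y | y i = g i}) / μ(E_{U \ {i}} | E_O)`. -/
theorem epistemic_uncertainty_eq_relative_posterior_gain
    {V : Type*} [Fintype V] [Nonempty V] {C : ℕ} (hC : 1 ≤ C)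
    [MeasurableSpace (V → Fin C)] [MeasurableSingletonClass (V → Fin C)]
    (μ : Measure (V → Fin C)) [IsProbabilityMeasure μ]
    (g : V → Fin C) (O : Set V)
    (hpos : 0 < μ (groundTruthEvent g Set.univ))
    (i : V) (hi : i ∈ Oᶜ) :
    (μ[|groundTruthEvent g O] {y | y i = g i})⁻¹
        / (μ[|groundTruthEvent g ({i}ᶜ)] {y | y i = g i})⁻¹
      = μ[|groundTruthEvent g O ∩ {y | y i = g i}] (groundTruthEvent g (Oᶜ \ {i}))
        / μ[|groundTruthEvent g O] (groundTruthEvent g (Oᶜ \ {i})) := by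
  have hcompl : ({i}ᶜ : Set V) = O ∪ Oᶜ \ {i} := by
    ext v
    by_cases hv : v ∈ O
    · simpa [hv] using fun h : v = i => hi (h ▸ hv)
    · simp [hv]
  have huniv : (Set.univ : Set V) = O ∪ {i} ∪ Oᶜ \ {i} := by
    rw [Set.union_right_comm, ← hcompl, Set.compl_union_self]
  rw [huniv, groundTruthEvent_union, groundTruthEvent_union, groundTruthEvent_singleton] at hpos
  rw [hcompl, groundTruthEvent_union]
  exact cond_inv_div_cond_inter_inv μ (Set.toFinite _).measurableSet
    (Set.toFinite _).measurableSet (Set.toFinite _).measurableSet hpos.ne'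
end

section
/- Corollary of Theorem 1 (epistemic queries maximize posterior gain). Define for each unobserved node k ∈ U the relative posterior gain gain(k) := μ(E_{U \ {k}} | E_O ∩ {y | y k = g k}) / μ(E_{U \ {k}} | E_O). Then for all i, j ∈ U one has u_epi(i) ≤ u_epi(j) if and only if gain(i) ≤ gain(j); consequently a node i ∈ U maximizes the epistemic uncertainty u_epi over U if and only if it maximizes the relative gain gain over U. -/
open MeasureTheory ProbabilityTheory

theorem groundTruthEvent_inter {V : Type*} {C : ℕ} (g : V → Fin C) (S T : Set V) :
    groundTruthEvent g S ∩ groundTruthEvent g T = groundTruthEvent g (S ∪ T) := by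
  ext y
  simp only [groundTruthEvent, Set.mem_inter_iff, Set.mem_ofPred_eq, Set.mem_union, or_imp,
    forall_and]

theorem groundTruthEvent_anti {V : Type*} {C : ℕ} (g : V → Fin C) {S T : Set V} (h : S ⊆ T) :
    groundTruthEvent g T ⊆ groundTruthEvent g S :=
  fun _ hy v hv => hy v (h hv)

/-- The epistemic uncertainty of an unobserved node equals its relative posterior gain. -/
theorem epistemic_uncertainty_eq_gain {V : Type*} [Finite V] {C : ℕ}
    [MeasurableSpace (V → Fin C)] [MeasurableSingletonClass (V → Fin C)]
    (μ : Measure (V → Fin C)) [IsFiniteMeasure μ] (g : V → Fin C) {O : Set V}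
    (hpos : 0 < μ (groundTruthEvent g Set.univ)) {i : V} (hi : i ∈ Oᶜ) :
    (μ[|groundTruthEvent g O] {y | y i = g i})⁻¹
        / (μ[|groundTruthEvent g ({i}ᶜ)] {y | y i = g i})⁻¹ =
      μ[|groundTruthEvent g O ∩ {y | y i = g i}] (groundTruthEvent g (Oᶜ \ {i}))
        / μ[|groundTruthEvent g O] (groundTruthEvent g (Oᶜ \ {i})) := by
  have ne_zero (S : Set V) : μ (groundTruthEvent g S) ≠ 0 :=
    (hpos.trans_le (measure_mono (groundTruthEvent_anti g S.subset_univ))).ne'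
  have ne_top (S : Set V) : μ (groundTruthEvent g S) ≠ ⊤ := measure_ne_top _ _
  have compl_union : ({i}ᶜ ∪ {i} : Set V) = Set.univ := Set.compl_union_self _
  have union_univ : O ∪ {i} ∪ Oᶜ \ {i} = Set.univ := by
    ext v; simp only [Set.mem_union, Set.mem_sdiff, Set.mem_compl_iff, Set.mem_univ]; tauto
  have union_compl : O ∪ Oᶜ \ {i} = {i}ᶜ := by
    ext v
    have : v ∈ O → v ≠ i := fun hv h => hi (h ▸ hv)
    simp only [Set.mem_union, Set.mem_sdiff, Set.mem_compl_iff, Set.mem_singleton_iff]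
    tauto
  rw [← groundTruthEvent_singleton, groundTruthEvent_inter]
  simp only [cond_apply (Set.toFinite _).measurableSet, groundTruthEvent_inter, compl_union,
    union_univ, union_compl, div_eq_mul_inv, inv_inv]
  rw [ENNReal.mul_inv (.inl (ENNReal.inv_ne_zero.2 (ne_top _)))
      (.inl (ENNReal.inv_ne_top.2 (ne_zero _))),
    ENNReal.mul_inv (.inl (ENNReal.inv_ne_zero.2 (ne_top _)))
      (.inl (ENNReal.inv_ne_top.2 (ne_zero _))), inv_inv]
  ring

/-- **Corollary of Theorem 1 (epistemic queries maximize posterior gain).**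
With `gain k := μ(E_{U \ {k}} | E_O ∩ {y | y k = g k}) / μ(E_{U \ {k}} | E_O)`
for each unobserved node `k ∈ U = Oᶜ`, one has, for all `i, j ∈ U`,
`u_epi(i) ≤ u_epi(j) ↔ gain i ≤ gain j`; consequently a node `i ∈ U` maximizes
the epistemic uncertainty `u_epi` over `U` if and only if it maximizes the
relative gain `gain` over `U`. -/
theorem epistemic_maximizer_iff_gain_maximizer
    {V : Type*} [Fintype V] [Nonempty V] {C : ℕ} (hC : 1 ≤ C)
    [MeasurableSpace (V → Fin C)] [MeasurableSingletonClass (V → Fin C)]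
    (μ : Measure (V → Fin C)) [IsProbabilityMeasure μ]
    (g : V → Fin C) (O : Set V)
    (hpos : 0 < μ (groundTruthEvent g Set.univ))
    (uEpi gain : V → ENNReal)
    (huEpi : ∀ i, uEpi i =
      (μ[|groundTruthEvent g O] {y | y i = g i})⁻¹
        / (μ[|groundTruthEvent g ({i}ᶜ)] {y | y i = g i})⁻¹)
    (hgain : ∀ k, gain k =
      μ[|groundTruthEvent g O ∩ {y | y k = g k}] (groundTruthEvent g (Oᶜ \ {k}))
        / μ[|groundTruthEvent g O] (groundTruthEvent g (Oᶜ \ {k}))) :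
    (∀ i ∈ Oᶜ, ∀ j ∈ Oᶜ, (uEpi i ≤ uEpi j ↔ gain i ≤ gain j))
    ∧ ∀ i ∈ Oᶜ,
        ((∀ k ∈ Oᶜ, uEpi k ≤ uEpi i) ↔ ∀ k ∈ Oᶜ, gain k ≤ gain i) := by
  have uEpi_eq_gain : ∀ i ∈ Oᶜ, uEpi i = gain i := fun i hi => by
    rw [huEpi, hgain, epistemic_uncertainty_eq_gain μ g hpos hi]
  refine ⟨fun i hi j hj => by rw [uEpi_eq_gain i hi, uEpi_eq_gain j hj], fun i hi => ?_⟩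
  exact forall₂_congr fun k hk => by rw [uEpi_eq_gain i hi, uEpi_eq_gain k hk]
end

section
/- Mean-field coordinate update for the CSBM (optimality of the fixed-point equation). Fix a node i ∈ V and, for each j ≠ i, a probability vector γ j on Fin C. For a probability vector β on Fin C let γ^β denote the parameter collection with γ^β i = β and γ^β j = γ j for j ≠ i, let q^β(y) := ∏_v γ^β v (y v), and define the objective J(β) := Σ_{y : V → Fin C} q^β(y) · log (w(y)) + Σ_{v ∈ V} H(γ^β v). Define s : Fin C → ℝ by s c := log (π c) + log (ℓ i c) + Σ_{j < i} Σ_{c'} γ j c' · log (a j i c' c) + Σ_{j > i} Σ_{c'} γ j c' · log (a i j c c'). Then for every probability vector β on Fin C, J(β) ≤ J(β*), where β* c := exp (s c) / Σ_{c''} exp (s c''); i.e., the coordinate-wise maximizer of the evidence lower bound is given by the fixed-point equation γ_{i,c} ∝ exp( log p(y_i = c) + Σ_{j ≠ i} Σ_{c'} γ_{j,c'} · log p(A_{ij} | y_i = c, y_j = c') + log p(X_i | y_i = c) ). -/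
open Finset

section ProductExpectation

variable {V K : Type*} [Fintype V] [DecidableEq V] [Fintype K]

theorem sum_prod_mul_prod (Q h : V → K → ℝ) :
    ∑ y : V → K, (∏ v, Q v (y v)) * ∏ v, h v (y v) = ∏ v, ∑ c, Q v c * h v c := by
  simp_rw [← Finset.prod_mul_distrib]
  exact (Fintype.prod_sum fun v c => Q v c * h v c).symm

/-- Under a product of probability vectors, the expectation of a function of one coordinate is
computed from the marginal. -/
theorem sum_prod_mul_apply (Q : V → K → ℝ) (hQ : ∀ v, ∑ c, Q v c = 1) (u : V) (f : K → ℝ) :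
    ∑ y : V → K, (∏ v, Q v (y v)) * f (y u) = ∑ c, Q u c * f c := by
  have h := sum_prod_mul_prod Q (fun v c => if v = u then f c else 1)
  have h1 : ∀ v, ∑ c, Q v c * (if v = u then f c else 1)
      = if v = u then ∑ c, Q u c * f c else 1 := by
    intro v
    split_ifs with hv
    · rw [hv]
    · simp [hQ]
  rw [Finset.prod_congr rfl fun v _ => h1 v] at h
  simpa only [Finset.prod_ite_eq', Finset.mem_univ, if_true] using h

/-- Under a product of probability vectors, the expectation of a function of two distinct
coordinates is computed from the product of the two marginals. -/
theorem sum_prod_mul_apply_apply (Q : V → K → ℝ) (hQ : ∀ v, ∑ c, Q v c = 1) {u t : V}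
    (hut : u ≠ t) (f : K → K → ℝ) :
    ∑ y : V → K, (∏ v, Q v (y v)) * f (y u) (y t)
      = ∑ c, Q u c * ∑ c', Q t c' * f c c' := by
  classical
  have key : ∀ c, ∑ y : V → K, (∏ v, Q v (y v)) * ((if y u = c then 1 else 0) * f c (y t))
      = Q u c * ∑ c', Q t c' * f c c' := by
    intro c
    have h := sum_prod_mul_prod Q (fun v d =>
      (if v = u then (if d = c then 1 else 0) else 1) * (if v = t then f c d else 1))
    have h1 : ∀ v, ∑ d, Q v d *
        ((if v = u then (if d = c then 1 else 0) else 1) * (if v = t then f c d else 1))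
        = (if v = u then Q u c else 1) * (if v = t then ∑ c', Q t c' * f c c' else 1) := by
      intro v
      by_cases hu : v = u
      · subst hu
        simp [hut]
      · by_cases ht : v = t
        · subst ht
          simp [hu]
        · simp [hu, ht, hQ]
    rw [Finset.prod_congr rfl fun v _ => h1 v] at h
    simpa only [Finset.prod_mul_distrib, Finset.prod_ite_eq', Finset.mem_univ, if_true] using h
  rw [← Finset.sum_congr rfl fun c _ => key c, Finset.sum_comm]
  refine Finset.sum_congr rfl fun y _ => ?_
  rw [← Finset.mul_sum]
  simp

end ProductExpectation

/-- Gibbs' variational principle on a finite type: the softmax of `s` maximizes expected score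
plus entropy among probability vectors. -/
theorem sum_mul_add_entropy_le_softmax {K : Type*} [Fintype K] [Nonempty K] (s β : K → ℝ)
    (hβ0 : ∀ c, 0 ≤ β c) (hβ1 : ∑ c, β c = 1) :
    ∑ c, β c * s c + ∑ c, -(β c * Real.log (β c)) ≤
      ∑ c, (Real.exp (s c) / ∑ d, Real.exp (s d)) * s c
        + ∑ c, -((Real.exp (s c) / ∑ d, Real.exp (s d))
          * Real.log (Real.exp (s c) / ∑ d, Real.exp (s d))) := by
  set Z := ∑ d, Real.exp (s d) with hZ
  have hZ0 : 0 < Z := Finset.sum_pos (fun _ _ => Real.exp_pos _) Finset.univ_nonempty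
  have hsum : ∑ c, Real.exp (s c) / Z = 1 := by
    rw [← Finset.sum_div, ← hZ, div_self hZ0.ne']
  have hlog : ∀ c, Real.log (Real.exp (s c) / Z) = s c - Real.log Z := fun c => by
    rw [Real.log_div (Real.exp_pos _).ne' hZ0.ne', Real.log_exp]
  have hright : ∑ c, (Real.exp (s c) / Z) * s c
      + ∑ c, -((Real.exp (s c) / Z) * Real.log (Real.exp (s c) / Z)) = Real.log Z := by
    rw [← Finset.sum_add_distrib]
    calc _ = ∑ c, Real.exp (s c) / Z * Real.log Z :=
          Finset.sum_congr rfl fun c _ => by rw [hlog]; ring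
      _ = Real.log Z := by rw [← Finset.sum_mul, hsum, one_mul]
  rw [hright, ← Finset.sum_add_distrib]
  have hterm : ∀ c, β c * s c + -(β c * Real.log (β c))
      ≤ β c * Real.log Z + (Real.exp (s c) / Z - β c) := by
    intro c
    rcases (hβ0 c).eq_or_lt with h | h
    · rw [← h]
      simp only [zero_mul, neg_zero, add_zero, sub_zero, zero_add]
      positivity
    · have hq : 0 < Real.exp (s c) / Z := by positivity
      have h1 := Real.log_le_sub_one_of_pos (div_pos hq h)
      rw [Real.log_div hq.ne' h.ne', hlog] at h1
      have h2 := mul_le_mul_of_nonneg_left h1 h.le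
      have h3 : β c * (Real.exp (s c) / Z / β c - 1) = Real.exp (s c) / Z - β c := by
        field_simp
      rw [h3] at h2
      linarith
  calc _ ≤ ∑ c, (β c * Real.log Z + (Real.exp (s c) / Z - β c)) :=
        Finset.sum_le_sum fun c _ => hterm c
    _ = Real.log Z := by
      rw [Finset.sum_add_distrib, Finset.sum_sub_distrib, ← Finset.sum_mul, hβ1, hsum]
      ring

theorem sum_apply_update {V M : Type*} [Fintype V] [DecidableEq V] (γ : V → M) (i : V) (β : M)
    (F : V → M → ℝ) :
    ∑ v, F v (Function.update γ i β v) = F i β + ∑ v ∈ {i}ᶜ, F v (γ v) := by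
  rw [Fintype.sum_eq_add_sum_compl i, Function.update_self]
  congr 1
  refine Finset.sum_congr rfl fun v hv => ?_
  rw [Function.update_of_ne (by simpa using hv)]

/-- Splitting a sum over ordered pairs after one coordinate has been updated. -/
theorem sum_lt_pairs_update {V M : Type*} [Fintype V] [LinearOrder V] (γ : V → M) (i : V) (β : M)
    (F : V → V → M → M → ℝ) :
    ∑ p ∈ Finset.univ.filter (fun p : V × V => p.1 < p.2),
        F p.1 p.2 (Function.update γ i β p.1) (Function.update γ i β p.2)
      = ∑ j ∈ Finset.univ.filter (fun j => j < i), F j i (γ j) β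
        + ∑ j ∈ Finset.univ.filter (fun j => i < j), F i j β (γ j)
        + ∑ p ∈ Finset.univ.filter (fun p : V × V => p.1 < p.2),
            if p.1 ≠ i ∧ p.2 ≠ i then F p.1 p.2 (γ p.1) (γ p.2) else 0 := by
  have h : ∀ j k : V,
      (if j < k then F j k (Function.update γ i β j) (Function.update γ i β k) else 0)
        = (if k = i then (if j < i then F j i (γ j) β else 0) else 0)
          + (if j = i then (if i < k then F i k β (γ k) else 0) else 0)
          + (if j < k then (if j ≠ i ∧ k ≠ i then F j k (γ j) (γ k) else 0) else 0) := by
    intro j k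
    by_cases hj : j = i
    · subst hj
      by_cases hk : k = j
      · subst hk
        simp
      · simp [hk]
    · by_cases hk : k = i
      · subst hk
        simp [hj]
      · simp [hj, hk]
  simp only [Finset.sum_filter, Fintype.sum_prod_type]
  simp_rw [h, Finset.sum_add_distrib]
  congr 2
  · simp
  · rw [Finset.sum_comm]
    simp

/-- The expected log joint weight of the CSBM under a product distribution. -/
theorem sum_prod_mul_log_csbm {V K : Type*} [Fintype V] [LinearOrder V] [Fintype K]
    (π : K → ℝ) (hπ : ∀ c, 0 < π c)
    (a : V → V → K → K → ℝ) (ha : ∀ i j c c', 0 < a i j c c')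
    (ℓ : V → K → ℝ) (hℓ : ∀ v c, 0 < ℓ v c)
    (Q : V → K → ℝ) (hQ : ∀ v, ∑ c, Q v c = 1) :
    ∑ y : V → K, (∏ v, Q v (y v)) * Real.log ((∏ v, π (y v)) *
        (∏ p ∈ Finset.univ.filter (fun p : V × V => p.1 < p.2),
          a p.1 p.2 (y p.1) (y p.2)) * ∏ v, ℓ v (y v))
      = ∑ v, ∑ c, Q v c * (Real.log (π c) + Real.log (ℓ v c))
        + ∑ p ∈ Finset.univ.filter (fun p : V × V => p.1 < p.2),
            ∑ c, Q p.1 c * ∑ c', Q p.2 c' * Real.log (a p.1 p.2 c c') := by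
  have hlog : ∀ y : V → K, Real.log ((∏ v, π (y v)) *
        (∏ p ∈ Finset.univ.filter (fun p : V × V => p.1 < p.2),
          a p.1 p.2 (y p.1) (y p.2)) * ∏ v, ℓ v (y v))
      = ∑ v, (Real.log (π (y v)) + Real.log (ℓ v (y v)))
        + ∑ p ∈ Finset.univ.filter (fun p : V × V => p.1 < p.2),
            Real.log (a p.1 p.2 (y p.1) (y p.2)) := by
    intro y
    have h1 : ∏ v, π (y v) ≠ 0 := Finset.prod_ne_zero_iff.2 fun v _ => (hπ _).ne'
    have h2 : ∏ p ∈ Finset.univ.filter (fun p : V × V => p.1 < p.2),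
        a p.1 p.2 (y p.1) (y p.2) ≠ 0 := Finset.prod_ne_zero_iff.2 fun p _ => (ha _ _ _ _).ne'
    have h3 : ∏ v, ℓ v (y v) ≠ 0 := Finset.prod_ne_zero_iff.2 fun v _ => (hℓ _ _).ne'
    rw [Real.log_mul (mul_ne_zero h1 h2) h3, Real.log_mul h1 h2,
      Real.log_prod fun v _ => (hπ _).ne', Real.log_prod fun p _ => (ha _ _ _ _).ne',
      Real.log_prod fun v _ => (hℓ _ _).ne', Finset.sum_add_distrib]
    ring
  rw [Finset.sum_congr rfl fun y _ => by rw [hlog y, mul_add, Finset.mul_sum, Finset.mul_sum],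
    Finset.sum_add_distrib]
  congr 1
  · rw [Finset.sum_comm]
    exact Finset.sum_congr rfl fun v _ =>
      sum_prod_mul_apply Q hQ v fun c => Real.log (π c) + Real.log (ℓ v c)
  · rw [Finset.sum_comm]
    exact Finset.sum_congr rfl fun p hp =>
      sum_prod_mul_apply_apply Q hQ (Finset.mem_filter.1 hp).2.ne fun c c' =>
        Real.log (a p.1 p.2 c c')

/-- **Mean-field coordinate update for the CSBM (optimality of the fixed-point
equation).**
Fix a node `i` and, for each `j ≠ i`, a probability vector `γ j` on `Fin C`.
For a probability vector `β`, let `γ^β = Function.update γ i β`, let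
`q^β y = ∏ v, γ^β v (y v)`, and define the objective
`J β = ∑ y, q^β y * log (w y) + ∑ v, H(γ^β v)` where `w` is the CSBM joint
weight. With
`s c = log (π c) + log (ℓ i c) + ∑_{j < i} ∑_{c'} γ j c' * log (a j i c' c)
      + ∑_{j > i} ∑_{c'} γ j c' * log (a i j c c')`,
every probability vector `β` satisfies `J β ≤ J β*` where
`β* c = exp (s c) / ∑ c'', exp (s c'')`; i.e., the coordinate-wise maximizer of
the evidence lower bound is given by the mean-field fixed-point equation. -/
theorem csbm_mean_field_coordinate_update
    {V : Type*} [Fintype V] [Nonempty V] [LinearOrder V] {C : ℕ} (hC : 1 ≤ C)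
    (π : Fin C → ℝ) (hπ : ∀ c, 0 < π c)
    (a : V → V → Fin C → Fin C → ℝ) (ha : ∀ i j c c', 0 < a i j c c')
    (ℓ : V → Fin C → ℝ) (hℓ : ∀ v c, 0 < ℓ v c)
    (i : V) (γ : V → Fin C → ℝ)
    (hγ0 : ∀ j, j ≠ i → ∀ c, 0 ≤ γ j c)
    (hγ1 : ∀ j, j ≠ i → ∑ c, γ j c = 1)
    (w : (V → Fin C) → ℝ)
    (hw : ∀ y, w y =
      (∏ v, π (y v)) *
        (∏ p ∈ Finset.univ.filter (fun p : V × V => p.1 < p.2),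
          a p.1 p.2 (y p.1) (y p.2)) *
        ∏ v, ℓ v (y v))
    (J : (Fin C → ℝ) → ℝ)
    (hJ : ∀ β, J β =
      (∑ y : V → Fin C,
          (∏ v, Function.update γ i β v (y v)) * Real.log (w y))
        + ∑ v, ∑ c,
            -(Function.update γ i β v c * Real.log (Function.update γ i β v c)))
    (s : Fin C → ℝ)
    (hs : ∀ c, s c = Real.log (π c) + Real.log (ℓ i c)
        + (∑ j ∈ Finset.univ.filter (fun j => j < i),
            ∑ c', γ j c' * Real.log (a j i c' c))
        + ∑ j ∈ Finset.univ.filter (fun j => i < j),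
            ∑ c', γ j c' * Real.log (a i j c c'))
    (β : Fin C → ℝ) (hβ0 : ∀ c, 0 ≤ β c) (hβ1 : ∑ c, β c = 1) :
    J β ≤ J (fun c => Real.exp (s c) / ∑ c'', Real.exp (s c'')) := by
  have : Nonempty (Fin C) := ⟨⟨0, hC⟩⟩
  obtain ⟨K, hK⟩ : ∃ K : ℝ, ∀ β : Fin C → ℝ, ∑ c, β c = 1 →
      J β = (∑ c, β c * s c + ∑ c, -(β c * Real.log (β c))) + K := by
    refine ⟨∑ v ∈ {i}ᶜ, ∑ c, γ v c * (Real.log (π c) + Real.log (ℓ v c))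
      + ∑ p ∈ Finset.univ.filter (fun p : V × V => p.1 < p.2),
          (if p.1 ≠ i ∧ p.2 ≠ i then
            ∑ c, γ p.1 c * ∑ c', γ p.2 c' * Real.log (a p.1 p.2 c c') else 0)
      + ∑ v ∈ {i}ᶜ, ∑ c, -(γ v c * Real.log (γ v c)), fun β hβ => ?_⟩
    have hQ : ∀ v, ∑ c, Function.update γ i β v c = 1 := by
      intro v
      by_cases hv : v = i
      · subst hv
        simpa using hβ
      · simpa [hv] using hγ1 v hv
    have hlin : ∑ c, β c * s c = ∑ c, β c * (Real.log (π c) + Real.log (ℓ i c))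
        + (∑ j ∈ Finset.univ.filter (fun j => j < i),
            ∑ c, γ j c * ∑ c', β c' * Real.log (a j i c c')
          + ∑ j ∈ Finset.univ.filter (fun j => i < j),
            ∑ c, β c * ∑ c', γ j c' * Real.log (a i j c c')) := by
      simp_rw [hs, mul_add, Finset.sum_add_distrib, Finset.mul_sum]
      rw [add_assoc]
      congr 2
      · rw [Finset.sum_comm]
        refine Finset.sum_congr rfl fun j _ => ?_
        rw [Finset.sum_comm]
        exact Finset.sum_congr rfl fun c _ => Finset.sum_congr rfl fun c' _ =>
          mul_left_comm _ _ _
      · rw [Finset.sum_comm]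
    rw [hJ]
    simp_rw [hw]
    rw [sum_prod_mul_log_csbm π hπ a ha ℓ hℓ _ hQ,
      sum_apply_update γ i β fun v b => ∑ c, b c * (Real.log (π c) + Real.log (ℓ v c)),
      sum_apply_update γ i β fun _ b => ∑ c, -(b c * Real.log (b c)),
      sum_lt_pairs_update γ i β fun u t b b' =>
        ∑ c, b c * ∑ c', b' c' * Real.log (a u t c c'), hlin]
    have rearrange : ∀ x x' p r h h' : ℝ,
        x + x' + (p + r) + (h + h') = x + p + h + (x' + r + h') := fun _ _ _ _ _ _ => by ring
    exact rearrange _ _ _ _ _ _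
  have hZ0 : 0 < ∑ d, Real.exp (s d) :=
    Finset.sum_pos (fun _ _ => Real.exp_pos _) Finset.univ_nonempty
  rw [hK β hβ1, hK _ (by rw [← Finset.sum_div, div_self hZ0.ne'])]
  exact add_le_add_left (sum_mul_add_entropy_le_softmax s β hβ0 hβ1) K
end
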